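/- arXiv:2412.21031 — 6 statements merged into one kernel-verified Lean document; each statement's English description precedes it below -/
import Mathlib

section
/- Let n ≥ 1 and d ≥ 1. Identify monomials of K[x_1,…,x_n] with their exponent vectors a ∈ ℕ^n, with degree |a| = a_1 + … + a_n, and let a ∨ b denote the componentwise maximum (the exponent vector of lcm). For a set U of exponent vectors all of the same degree e, say that α, β ∈ U are U-connected if there is a finite sequence α = w_0, w_1, …, w_r = β of elements of U such that w_t ≤ α ∨ β componentwise for every t, and |w_t ∨ w_{t+1}| = e + 1 for every 0 ≤ t ≤ r−1. Let V be a finite set of exponent vectors all of degree d such that every pair of elements of V is V-connected. Let W = { a + e_i : a ∈ V, 1 ≤ i ≤ n, and there exist an index j ≠ i and b ∈ V with a + e_i = b + e_j }, where e_i denotes the i-th standard unit vector; all elements of W have degree d + 1. Then every pair of elements of W is W-connected. -/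
open Finset

/-- A chain of linear steps in `U` below `m` can be listed as a finite sequence. -/
lemma exists_sequence_of_reflTransGen {n : ℕ} {U : Set (Fin n → ℕ)} {e : ℕ}
    {m α β : Fin n → ℕ} (hα : α ∈ U) (hαm : α ≤ m)
    (h : Relation.ReflTransGen
      (fun x y => y ∈ U ∧ y ≤ m ∧ (∑ i, max (x i) (y i)) = e + 1) α β) :
    ∃ (r : ℕ) (w : ℕ → (Fin n → ℕ)), w 0 = α ∧ w r = β ∧ (∀ t ≤ r, w t ∈ U) ∧
      (∀ t ≤ r, w t ≤ m) ∧ (∀ t < r, (∑ i, max (w t i) (w (t + 1) i)) = e + 1) := by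
  induction h with
  | refl => exact ⟨0, fun _ => α, rfl, rfl, fun _ _ => hα, fun _ _ => hαm, by simp⟩
  | @tail b c _ hbc ih =>
    obtain ⟨r, w, h0, hr, hU, hm, hs⟩ := ih
    obtain ⟨hcU, hcm, hsum⟩ := hbc
    refine ⟨r + 1, fun t => if t ≤ r then w t else c, by simp [h0], by simp, ?_, ?_, ?_⟩
    · intro t _
      by_cases h : t ≤ r
      · simpa [h] using hU t h
      · simpa [h] using hcU
    · intro t _
      by_cases h : t ≤ r
      · simpa only [h, if_true] using hm t h
      · simpa only [h, if_false] using hcm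
    · intro t ht
      rcases Nat.lt_succ_iff_lt_or_eq.mp ht with h | rfl
      · simpa only [h.le, Nat.succ_le_of_lt h, if_true] using hs t h
      · simpa [hr] using hsum

lemma eq_or_sum_max_eq_of_le {n d : ℕ} {a x y : Fin n → ℕ} (ha : ∑ i, a i = d)
    (hx : ∑ i, x i = d + 1) (hy : ∑ i, y i = d + 1) (hax : a ≤ x) (hay : a ≤ y) :
    x = y ∨ ∑ i, max (x i) (y i) = d + 1 + 1 := by
  have hmm : ∑ i, max (x i) (y i) + ∑ i, min (x i) (y i) = ∑ i, x i + ∑ i, y i := by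
    rw [← sum_add_distrib, ← sum_add_distrib]
    exact sum_congr rfl fun i _ => max_add_min _ _
  have hmin : ∑ i, a i ≤ ∑ i, min (x i) (y i) :=
    sum_le_sum fun i _ => le_min (hax i) (hay i)
  have hxm : ∑ i, x i ≤ ∑ i, max (x i) (y i) := sum_le_sum fun i _ => le_max_left _ _
  by_cases h : ∑ i, max (x i) (y i) = d + 1
  · left
    have h1 := (sum_eq_sum_iff_of_le fun i _ => le_max_left (x i) (y i)).mp (hx.trans h.symm)
    have h2 := (sum_eq_sum_iff_of_le fun i _ => le_max_right (x i) (y i)).mp (hy.trans h.symm)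
    funext i
    exact (h1 i (mem_univ i)).trans (h2 i (mem_univ i)).symm
  · right
    omega

lemma exists_eq_add_single_of_le {n : ℕ} {a x : Fin n → ℕ} (hax : a ≤ x)
    (h : ∑ i, x i = ∑ i, a i + 1) : ∃ i, x = a + Pi.single i 1 := by
  obtain ⟨i, -, hi⟩ := exists_lt_of_sum_lt (s := univ) (f := a) (g := x) (by omega)
  have hle : ∀ k ∈ univ, (a + Pi.single i 1 : Fin n → ℕ) k ≤ x k := by
    intro k _
    by_cases hk : k = i
    · subst hk
      simpa using hi
    · simpa [hk] using hax k
  have hsum : ∑ k, (a + Pi.single i 1 : Fin n → ℕ) k = ∑ k, x k := by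
    simp [sum_add_distrib, h]
  exact ⟨i, funext fun k => ((sum_eq_sum_iff_of_le hle).mp hsum k (mem_univ k)).symm⟩


open Finset

/-- `ConnectedIn U e α β` : there is a finite sequence `α = w 0, w 1, …, w r = β` of elements
of `U` such that each `w t` is componentwise bounded by `α ⊔ β` (the exponent vector of the
lcm) and consecutive terms satisfy `|w t ∨ w (t+1)| = e + 1`. -/
def ConnectedIn {n : ℕ} (U : Set (Fin n → ℕ)) (e : ℕ) (α β : Fin n → ℕ) : Prop :=
  ∃ (r : ℕ) (w : ℕ → (Fin n → ℕ)),
    w 0 = α ∧ w r = β ∧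
    (∀ t ≤ r, w t ∈ U) ∧
    (∀ t ≤ r, w t ≤ α ⊔ β) ∧
    (∀ t < r, (∑ i, max (w t i) (w (t + 1) i)) = e + 1)

/-- Let `V` be a finite set of exponent vectors, all of degree `d`, such that every
pair of elements of `V` is `V`-connected. Let
`W = { a + e_i : a ∈ V, ∃ j ≠ i, ∃ b ∈ V, a + e_i = b + e_j }`.
Then every pair of elements of `W` is `W`-connected (in degree `d + 1`). -/
theorem stmt4 {n : ℕ} (hn : 1 ≤ n) (d : ℕ) (hd : 1 ≤ d)
    (V : Set (Fin n → ℕ)) (hVfin : V.Finite)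
    (hVdeg : ∀ a ∈ V, (∑ i, a i) = d)
    (hVconn : ∀ a ∈ V, ∀ b ∈ V, ConnectedIn V d a b)
    (W : Set (Fin n → ℕ))
    (hW : W = {w | ∃ a ∈ V, ∃ i : Fin n, w = a + Pi.single i 1 ∧
        ∃ j : Fin n, j ≠ i ∧ ∃ b ∈ V, a + Pi.single i 1 = b + Pi.single j 1}) :
    ∀ α ∈ W, ∀ β ∈ W, ConnectedIn W (d + 1) α β := by
  have hWdeg : ∀ w ∈ W, ∑ i, w i = d + 1 := by
    rw [hW]
    rintro _ ⟨a, ha, i, rfl, -⟩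
    simp [sum_add_distrib, hVdeg a ha]
  have hWdvd : ∀ w ∈ W, ∃ a ∈ V, a ≤ w := by
    rw [hW]
    rintro _ ⟨a, ha, i, rfl, -⟩
    exact ⟨a, ha, le_self_add⟩
  have hWsup : ∀ a ∈ V, ∀ b ∈ V, ∑ i, max (a i) (b i) = d + 1 → a ⊔ b ∈ W := by
    intro a ha b hb hab
    obtain ⟨i, hi⟩ := exists_eq_add_single_of_le (a := a) (x := a ⊔ b) le_sup_left
      (by rw [hVdeg a ha]; exact hab)
    obtain ⟨j, hj⟩ := exists_eq_add_single_of_le (a := b) (x := a ⊔ b) le_sup_right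
      (by rw [hVdeg b hb]; exact hab)
    rw [hW]
    refine ⟨a, ha, i, hi, j, ?_, b, hb, hi.symm.trans hj⟩
    rintro rfl
    have hba : a = b := add_right_cancel (hi.symm.trans hj)
    subst hba
    simp [hVdeg a ha] at hab
  intro α hα β hβ
  obtain ⟨a, ha, haα⟩ := hWdvd α hα
  obtain ⟨b, hb, hbβ⟩ := hWdvd β hβ
  obtain ⟨r, w, h0, hr, hV, hm, hs⟩ := hVconn a ha b hb
  have hm' : ∀ t ≤ r, w t ≤ α ⊔ β := fun t ht => (hm t ht).trans (sup_le_sup haα hbβ)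
  refine exists_sequence_of_reflTransGen hα le_sup_left ?_
  have key : ∀ t ≤ r, ∀ γ ∈ W, γ ≤ α ⊔ β → w t ≤ γ → Relation.ReflTransGen
      (fun x y => y ∈ W ∧ y ≤ α ⊔ β ∧ (∑ i, max (x i) (y i)) = d + 1 + 1) α γ := by
    intro t
    induction t with
    | zero =>
      intro _ γ hγ hγm hle
      rw [h0] at hle
      rcases eq_or_sum_max_eq_of_le (hVdeg a ha) (hWdeg α hα) (hWdeg γ hγ) haα hle with
        rfl | h
      · exact .refl
      · exact .single ⟨hγ, hγm, h⟩
    | succ t ih =>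
      intro ht γ hγ hγm hle
      have hc : w t ⊔ w (t + 1) ∈ W :=
        hWsup _ (hV t (by omega)) _ (hV (t + 1) ht) (hs t (by omega))
      have hpath := ih (by omega) _ hc (sup_le (hm' t (by omega)) (hm' (t + 1) ht)) le_sup_left
      rcases eq_or_sum_max_eq_of_le (hVdeg _ (hV (t + 1) ht)) (hWdeg _ hc) (hWdeg γ hγ)
        le_sup_right hle with h | h
      · rwa [h] at hpath
      · exact hpath.tail ⟨hγ, hγm, h⟩
  exact key r le_rfl β hβ le_sup_right (hr ▸ hbβ)
end

section
/- Let K be a field and S = K[x, y, z]. Let I = (x², y², xyz) and m = (x, y, z). Then for every k ≥ 1, the colon ideal I^k : m equals (x, y)^{2k}. -/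
open MvPolynomial

section

variable {R : Type*} [CommRing R]

/-- The `n`-th power of `(x, y)` is spanned by the monomials of `(x, y)`-degree at least `n`. -/
lemma span_X_zero_X_one_pow (n : ℕ) :
    (Ideal.span {X 0, X 1} : Ideal (MvPolynomial (Fin 3) R)) ^ n =
      Ideal.span ((fun d ↦ monomial d (1 : R)) '' {d : Fin 3 →₀ ℕ | n ≤ d 0 + d 1}) := by
  apply le_antisymm
  · induction n with
    | zero =>
      refine le_of_le_of_eq le_top (Eq.symm ?_)
      rw [Ideal.eq_top_iff_one]
      exact Ideal.subset_span ⟨0, by simp, rfl⟩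
    | succ n ih =>
      rw [pow_succ]
      refine (Ideal.mul_mono_left ih).trans ?_
      rw [Ideal.span_mul_span', Ideal.span_le]
      rintro _ ⟨_, ⟨d, hd, rfl⟩, _, hX, rfl⟩
      simp only [Set.mem_ofPred_eq] at hd
      rcases hX with rfl | rfl
      · refine Ideal.subset_span ⟨d + Finsupp.single 0 1, ?_, by simp [X, monomial_mul]⟩
        suffices n + 1 ≤ d 0 + 1 + d 1 by simpa
        omega
      · refine Ideal.subset_span ⟨d + Finsupp.single 1 1, ?_, by simp [X, monomial_mul]⟩
        suffices n + 1 ≤ d 0 + (d 1 + 1) by simpa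
        omega
  · rw [Ideal.span_le]
    rintro _ ⟨d, hd, rfl⟩
    have h0 : (X 0 : MvPolynomial (Fin 3) R) ∈ Ideal.span {X 0, X 1} :=
      Ideal.subset_span (by simp)
    have h1 : (X 1 : MvPolynomial (Fin 3) R) ∈ Ideal.span {X 0, X 1} :=
      Ideal.subset_span (by simp)
    have h := Ideal.mul_mem_mul (Ideal.pow_mem_pow h0 (d 0)) (Ideal.pow_mem_pow h1 (d 1))
    rw [← pow_add] at h
    have hmon : monomial d (1 : R) = X 0 ^ d 0 * X 1 ^ d 1 * X 2 ^ d 2 := by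
      rw [monomial_eq, Finsupp.prod_fintype _ _ (by simp)]
      simp [Fin.prod_univ_three]
    simp only [SetLike.mem_coe, hmon]
    exact Ideal.mul_mem_right _ _ (Ideal.pow_le_pow_right hd h)

lemma mem_span_X_zero_X_one_pow_iff {n : ℕ} {f : MvPolynomial (Fin 3) R} :
    f ∈ (Ideal.span {X 0, X 1} : Ideal (MvPolynomial (Fin 3) R)) ^ n ↔
      ∀ d ∈ f.support, n ≤ d 0 + d 1 := by
  rw [span_X_zero_X_one_pow, mem_ideal_span_monomial_image]
  refine forall₂_congr fun d _ ↦ ⟨?_, fun h ↦ ⟨d, h, le_rfl⟩⟩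
  rintro ⟨e, he, hle⟩
  exact le_trans he (add_le_add (hle 0) (hle 1))

lemma mem_span_X_zero_X_one_pow_of_mul_X_two_mem {n : ℕ} {f : MvPolynomial (Fin 3) R}
    (h : f * X 2 ∈ (Ideal.span {X 0, X 1} : Ideal (MvPolynomial (Fin 3) R)) ^ n) :
    f ∈ (Ideal.span {X 0, X 1} : Ideal (MvPolynomial (Fin 3) R)) ^ n := by
  rw [mem_span_X_zero_X_one_pow_iff] at h ⊢
  intro d hd
  have := h (d + Finsupp.single 2 1) (by
    rw [mem_support_iff, coeff_mul_X]
    exact mem_support_iff.mp hd)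
  simpa using this

end

section

variable {R : Type*} [CommRing R] (x y z : R)

lemma Ideal.span_sq_sq_mul_le_span_pair_sq :
    Ideal.span {x ^ 2, y ^ 2, x * y * z} ≤ Ideal.span {x, y} ^ 2 := by
  have hx : x ∈ Ideal.span {x, y} := Ideal.subset_span (by simp)
  have hy : y ∈ Ideal.span {x, y} := Ideal.subset_span (by simp)
  rw [Ideal.span_le]
  rintro _ (rfl | rfl | rfl)
  · exact Ideal.pow_mem_pow hx 2
  · exact Ideal.pow_mem_pow hy 2
  · rw [sq]
    exact Ideal.mul_mem_right _ _ (Ideal.mul_mem_mul hx hy)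

lemma Ideal.span_pair_sq : Ideal.span {x, y} ^ 2 = Ideal.span {x ^ 2, x * y, y ^ 2} := by
  rw [sq, Ideal.span_pair_mul_span_pair]
  congr 1
  ext
  simp [sq, mul_comm y x]

lemma Ideal.span_pair_sq_mul_le :
    Ideal.span {x, y} ^ 2 * Ideal.span {x, y, z} ≤ Ideal.span {x ^ 2, y ^ 2, x * y * z} := by
  have hx : x ^ 2 ∈ Ideal.span {x ^ 2, y ^ 2, x * y * z} := Ideal.subset_span (by simp)
  have hy : y ^ 2 ∈ Ideal.span {x ^ 2, y ^ 2, x * y * z} := Ideal.subset_span (by simp)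
  have hz : x * y * z ∈ Ideal.span {x ^ 2, y ^ 2, x * y * z} := Ideal.subset_span (by simp)
  rw [Ideal.span_pair_sq, Ideal.span_mul_span', Ideal.span_le]
  rintro _ ⟨_, rfl | rfl | rfl, c, hc, rfl⟩ <;> rw [SetLike.mem_coe]
  · exact Ideal.mul_mem_right _ _ hx
  · rcases hc with rfl | rfl | rfl
    · convert Ideal.mul_mem_right y _ hx using 1
      ring
    · convert Ideal.mul_mem_left _ x hy using 1
      ring
    · exact hz
  · exact Ideal.mul_mem_right _ _ hy

lemma Ideal.span_pair_sq_mul_span_pair_sq_le :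
    Ideal.span {x, y} ^ 2 * Ideal.span {x, y} ^ 2 ≤
      Ideal.span {x ^ 2, y ^ 2, x * y * z} * Ideal.span {x, y} ^ 2 := by
  have hx : x ^ 2 ∈ Ideal.span {x ^ 2, y ^ 2, x * y * z} := Ideal.subset_span (by simp)
  have hy : y ^ 2 ∈ Ideal.span {x ^ 2, y ^ 2, x * y * z} := Ideal.subset_span (by simp)
  rw [Ideal.span_pair_sq]
  have hx' : x ^ 2 ∈ Ideal.span {x ^ 2, x * y, y ^ 2} := Ideal.subset_span (by simp)
  have hxy' : x * y ∈ Ideal.span {x ^ 2, x * y, y ^ 2} := Ideal.subset_span (by simp)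
  have hy' : y ^ 2 ∈ Ideal.span {x ^ 2, x * y, y ^ 2} := Ideal.subset_span (by simp)
  nth_rewrite 1 2 [Ideal.span_mul_span']
  rw [Ideal.span_le]
  rintro _ ⟨_, rfl | rfl | rfl, c, hc, rfl⟩ <;> rw [SetLike.mem_coe]
  · exact Ideal.mul_mem_mul hx (Ideal.subset_span hc)
  · rcases hc with rfl | rfl | rfl
    · convert Ideal.mul_mem_mul hx hxy' using 1
      ring
    · convert Ideal.mul_mem_mul hx hy' using 1
      ring
    · convert Ideal.mul_mem_mul hy hxy' using 1
      ring
  · exact Ideal.mul_mem_mul hy (Ideal.subset_span hc)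

lemma Ideal.span_pair_pow_le (n : ℕ) :
    Ideal.span {x, y} ^ (2 * (n + 1)) ≤
      Ideal.span {x ^ 2, y ^ 2, x * y * z} ^ n * Ideal.span {x, y} ^ 2 := by
  induction n with
  | zero => simp
  | succ n ih =>
    calc Ideal.span {x, y} ^ (2 * (n + 1 + 1))
        = Ideal.span {x, y} ^ (2 * (n + 1)) * Ideal.span {x, y} ^ 2 := by rw [← pow_add, ← mul_add_one]
      _ ≤ Ideal.span {x ^ 2, y ^ 2, x * y * z} ^ n *
            (Ideal.span {x, y} ^ 2 * Ideal.span {x, y} ^ 2) := by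
          rw [← mul_assoc]
          exact Ideal.mul_mono_left ih
      _ ≤ _ := by
          rw [pow_succ _ n, mul_assoc (_ ^ n)]
          exact Ideal.mul_mono_right (Ideal.span_pair_sq_mul_span_pair_sq_le x y z)

end

/-- In `S = K[x,y,z]` (with `x = X 0`, `y = X 1`, `z = X 2`), for
`I = (x², y², xyz)` and `m = (x, y, z)`, and every `k ≥ 1`, the colon ideal `I^k : m`
equals `(x, y)^(2k)`. -/
theorem stmt5 {K : Type*} [Field K] (k : ℕ) (hk : 1 ≤ k)
    (I m : Ideal (MvPolynomial (Fin 3) K))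
    (hI : I = Ideal.span {X 0 ^ 2, X 1 ^ 2, X 0 * X 1 * X 2})
    (hm : m = Ideal.span {X 0, X 1, X 2}) :
    Submodule.colon (I ^ k) m
      = (Ideal.span {X 0, X 1} : Ideal (MvPolynomial (Fin 3) K)) ^ (2 * k) := by
  subst hI hm
  apply le_antisymm
  · intro f hf
    apply mem_span_X_zero_X_one_pow_of_mul_X_two_mem
    rw [pow_mul]
    exact Ideal.pow_right_mono (Ideal.span_sq_sq_mul_le_span_pair_sq _ _ _) k
      (Submodule.mem_colon.mp hf _ (Ideal.subset_span (by simp)))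
  · obtain ⟨n, rfl⟩ := Nat.exists_eq_add_of_le' hk
    intro f hf
    rw [Submodule.mem_colon]
    intro p hp
    have h := Ideal.mul_mem_mul (Ideal.span_pair_pow_le _ _ (X 2) n hf) hp
    rw [mul_assoc] at h
    rw [pow_succ]
    exact Ideal.mul_mono_right (Ideal.span_pair_sq_mul_le _ _ _) h
end

section
/- Let K be a field and S = K[x, y, z]. Let I = (x², y², xyz). Then for every k ≥ 1, the monomial x·y^{2k−1} does not belong to I^k, while each of x·(xy^{2k−1}), y·(xy^{2k−1}), and z·(xy^{2k−1}) belongs to I^k; that is, xy^{2k−1} ∈ (I^k : (x,y,z)) \ I^k. -/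
open MvPolynomial

/-- Send `x` to `ε`, `y` to the polynomial variable `Y` and `z` to `0` in `K[Y][ε]`: then `I` lands
in `(Y²)`, while `x * y ^ (2n+1)` goes to `ε Y ^ (2n+1)`, which `Y ^ (2n+2)` does not divide. -/
theorem X_mul_X_pow_notMem_span_pow {K : Type*} [Field K] (n : ℕ) :
    (X 0 * X 1 ^ (2 * n + 1) : MvPolynomial (Fin 3) K) ∉
      Ideal.span {X 0 ^ 2, X 1 ^ 2, X 0 * X 1 * X 2} ^ (n + 1) := by
  intro h
  let Y : DualNumber (Polynomial K) := TrivSqZeroExt.inl Polynomial.X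
  let φ : MvPolynomial (Fin 3) K →ₐ[K] DualNumber (Polynomial K) :=
    aeval ![DualNumber.eps, Y, 0]
  have hle : Ideal.map φ (Ideal.span {X 0 ^ 2, X 1 ^ 2, X 0 * X 1 * X 2}) ≤
      Ideal.span {Y ^ 2} := by
    rw [Ideal.map_span, Ideal.span_le]
    rintro _ ⟨p, rfl | rfl | rfl, rfl⟩
    · simp [φ, pow_two]
    · simp [φ]
    · simp [φ]
  have hmem := Ideal.pow_right_mono hle (n + 1)
    (Ideal.map_pow φ _ (n + 1) ▸ Ideal.mem_map_of_mem φ h)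
  rw [Ideal.span_singleton_pow, Ideal.mem_span_singleton] at hmem
  obtain ⟨c, hc⟩ := hmem
  have hsnd := congrArg TrivSqZeroExt.snd hc
  simp only [φ, Y, map_mul, map_pow, aeval_X] at hsnd
  have hdvd : (Polynomial.X : Polynomial K) ^ (2 * (n + 1)) ∣ Polynomial.X ^ (2 * n + 1) :=
    ⟨c.snd, by simpa [← pow_mul] using hsnd⟩
  have hdeg := (pow_dvd_pow_iff Polynomial.X_ne_zero Polynomial.not_isUnit_X).1 hdvd
  omega

/-- In `S = K[x,y,z]` (with `x = X 0`, `y = X 1`, `z = X 2`) and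
`I = (x², y², xyz)`, for every `k ≥ 1` the monomial `x·y^(2k-1)` does not belong to `I^k`,
while `x·(x y^(2k-1))`, `y·(x y^(2k-1))` and `z·(x y^(2k-1))` all belong to `I^k`. -/
theorem stmt6 {K : Type*} [Field K] (k : ℕ) (hk : 1 ≤ k)
    (I : Ideal (MvPolynomial (Fin 3) K))
    (hI : I = Ideal.span {X 0 ^ 2, X 1 ^ 2, X 0 * X 1 * X 2}) :
    X 0 * X 1 ^ (2 * k - 1) ∉ I ^ k ∧
    X 0 * (X 0 * X 1 ^ (2 * k - 1)) ∈ I ^ k ∧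
    X 1 * (X 0 * X 1 ^ (2 * k - 1)) ∈ I ^ k ∧
    X 2 * (X 0 * X 1 ^ (2 * k - 1)) ∈ I ^ k := by
  subst hI
  obtain ⟨n, rfl⟩ := Nat.exists_eq_add_of_le' hk
  rw [show 2 * (n + 1) - 1 = 2 * n + 1 by omega]
  set I : Ideal (MvPolynomial (Fin 3) K) := Ideal.span {X 0 ^ 2, X 1 ^ 2, X 0 * X 1 * X 2}
  have hx : X 0 ^ 2 ∈ I := Ideal.subset_span (by simp)
  have hy : X 1 ^ 2 ∈ I := Ideal.subset_span (by simp)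
  have hxyz : X 0 * X 1 * X 2 ∈ I := Ideal.subset_span (by simp)
  have mul_mem {p : MvPolynomial (Fin 3) K} (hp : p ∈ I) : (X 1 ^ 2) ^ n * p ∈ I ^ (n + 1) :=
    pow_succ I n ▸ Ideal.mul_mem_mul (Ideal.pow_mem_pow hy n) hp
  refine ⟨X_mul_X_pow_notMem_span_pow n, ?_, ?_, ?_⟩
  · convert Ideal.mul_mem_left _ (X 1) (mul_mem hx) using 1
    ring
  · convert Ideal.mul_mem_left _ (X 0) (mul_mem hy) using 1
    ring
  · convert mul_mem hxyz using 1
    ring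
end

section
/- Let K be a field and S = K[x, y, z]. Let I = (x², y², xyz). Then for every k ≥ 1 and all nonnegative integers p, q with p + q = 2k, the monomial x^p y^q belongs to I^k if and only if p is even. -/
open MvPolynomial

/-- Every power of `(x², y², xyz)` is contained in the monomial ideal spanned by the multiples of
`z` and the multiples of `x^(2a) y^(2b)` with `a + b = k`. -/
theorem span_sq_sq_mul_pow_le {K : Type*} [Field K] (k : ℕ) :
    (Ideal.span {X 0 ^ 2, X 1 ^ 2, X 0 * X 1 * X 2} : Ideal (MvPolynomial (Fin 3) K)) ^ k ≤
      Ideal.span ((fun s => monomial s (1 : K)) ''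
        {s | 1 ≤ s 2 ∨ ∃ a b, a + b = k ∧ 2 * a ≤ s 0 ∧ 2 * b ≤ s 1}) := by
  induction k with
  | zero =>
    rw [pow_zero, Ideal.one_eq_top, top_le_iff, Ideal.eq_top_iff_one]
    exact Ideal.subset_span ⟨0, Or.inr ⟨0, 0, by simp⟩, rfl⟩
  | succ k ih =>
    rw [pow_succ]
    refine (Ideal.mul_mono_left ih).trans ?_
    rw [Ideal.span_mul_span', Ideal.span_le]
    rintro _ ⟨_, ⟨s, hs, rfl⟩, g, hg, rfl⟩
    simp only [Set.mem_insert_iff, Set.mem_singleton_iff] at hg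
    rcases hg with rfl | rfl | rfl
    · refine Ideal.subset_span ⟨s + Finsupp.single 0 2, ?_, ?_⟩
      · rcases hs with h | ⟨a, b, h, ha, hb⟩
        · exact Or.inl (by simpa using h)
        · exact Or.inr ⟨a + 1, b, by lia, by simp; lia, by simpa using hb⟩
      · simp [X_pow_eq_monomial, monomial_mul]
    · refine Ideal.subset_span ⟨s + Finsupp.single 1 2, ?_, ?_⟩
      · rcases hs with h | ⟨a, b, h, ha, hb⟩
        · exact Or.inl (by simpa using h)
        · exact Or.inr ⟨a, b + 1, by lia, by simpa using ha, by simp; lia⟩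
      · simp [X_pow_eq_monomial, monomial_mul]
    · refine Ideal.subset_span
        ⟨s + (Finsupp.single 0 1 + Finsupp.single 1 1 + Finsupp.single 2 1), ?_, ?_⟩
      · exact Or.inl (by simp)
      · simp [X, monomial_mul]

/-- In `S = K[x,y,z]` (with `x = X 0`, `y = X 1`, `z = X 2`) and
`I = (x², y², xyz)`, for every `k ≥ 1` and all `p, q` with `p + q = 2k`, the monomial
`x^p y^q` belongs to `I^k` if and only if `p` is even. -/
theorem stmt7 {K : Type*} [Field K] (k : ℕ) (hk : 1 ≤ k)
    (I : Ideal (MvPolynomial (Fin 3) K))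
    (hI : I = Ideal.span {X 0 ^ 2, X 1 ^ 2, X 0 * X 1 * X 2})
    (p q : ℕ) (hpq : p + q = 2 * k) :
    X 0 ^ p * X 1 ^ q ∈ I ^ k ↔ Even p := by
  subst hI
  constructor
  · intro h
    have h' := mem_ideal_span_monomial_image.mp (span_sq_sq_mul_pow_le k h)
      (Finsupp.single 0 p + Finsupp.single 1 q)
      (by simp [X_pow_eq_monomial, monomial_mul, mem_support_iff])
    obtain ⟨s, hs, hle⟩ := h'
    have h0 := hle 0
    have h1 := hle 1
    have h2 := hle 2
    simp at h0 h1 h2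
    rcases hs with hs | ⟨a, b, hab, ha, hb⟩
    · lia
    · exact ⟨a, by lia⟩
  · rintro ⟨a, rfl⟩
    obtain ⟨b, rfl⟩ := Nat.exists_eq_add_of_le (show a ≤ k by lia)
    obtain rfl : q = 2 * b := by lia
    rw [← two_mul, pow_mul, pow_mul, pow_add]
    exact Ideal.mul_mem_mul (Ideal.pow_mem_pow (Ideal.subset_span (by simp)) _)
      (Ideal.pow_mem_pow (Ideal.subset_span (by simp)) _)
end

section
/- Let K be a field, S = K[x, y], and k ≥ 1. Let J be the ideal generated by the monomials x^{k+1−i} y^i for i = 1, …, k, and let ∂J be the ideal generated by the partial derivatives ∂g/∂x and ∂g/∂y of these generators g. Then x^{2k} ∈ (∂J)² and x^{2k} ∉ J; in particular (∂J)² ⊄ J, so J is not strongly Golod. -/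
open MvPolynomial

/-- In `S = K[x,y]` (with `x = X 0`, `y = X 1`), let `k ≥ 1`, let `J` be the ideal
generated by the monomials `x^(k+1-i) y^i` for `i = 1, …, k`, and let `∂J` be the ideal generated
by the partial derivatives of these generators. Then `x^(2k) ∈ (∂J)²` and `x^(2k) ∉ J`. -/
theorem stmt8 {K : Type*} [Field K] (k : ℕ) (hk : 1 ≤ k)
    (G : Set (MvPolynomial (Fin 2) K))
    (hG : G = (fun i : ℕ => X 0 ^ (k + 1 - i) * X 1 ^ i) '' (Set.Icc 1 k))
    (J DJ : Ideal (MvPolynomial (Fin 2) K))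
    (hJ : J = Ideal.span G)
    (hDJ : DJ = Ideal.span ((fun g => pderiv 0 g) '' G ∪ (fun g => pderiv 1 g) '' G)) :
    X 0 ^ (2 * k) ∈ DJ ^ 2 ∧ X 0 ^ (2 * k) ∉ J := by
  subst hG hJ hDJ
  constructor
  · rw [mul_comm 2 k, pow_mul]
    refine Ideal.pow_mem_pow (Ideal.subset_span (Set.mem_union_right _ ?_)) 2
    refine ⟨X 0 ^ (k + 1 - 1) * X 1 ^ 1, ⟨1, ⟨le_rfl, hk⟩, rfl⟩, ?_⟩
    simp [Derivation.leibniz, Derivation.leibniz_pow, pderiv_X]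
  · intro hmem
    -- Every generator of `J` vanishes at the point `(1, 0)`, while `x ^ (2 * k)` does not.
    have hle : Ideal.span ((fun i : ℕ => (X 0 ^ (k + 1 - i) * X 1 ^ i : MvPolynomial (Fin 2) K)) ''
        Set.Icc 1 k) ≤ RingHom.ker (eval ![(1 : K), 0]) := by
      rw [Ideal.span_le]
      rintro _ ⟨i, hi, rfl⟩
      have hi0 : i ≠ 0 := Nat.one_le_iff_ne_zero.mp hi.1
      simp [RingHom.mem_ker, hi0]
    have h := hle hmem
    simp [RingHom.mem_ker] at h
end

section
/- Let K be a field, S = K[x_1,…,x_n], and let u_1, …, u_m be monomials in S, each of positive degree, with pairwise disjoint supports. Let R = K[y_1,…,y_m] and let φ : R → S be the K-algebra homomorphism with φ(y_i) = u_i for all i. Then S, regarded as an R-module via φ, is flat. -/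
open MvPolynomial

section ExponentDecomposition

variable {σ ι : Type*} [Fintype ι] {a : ι → (σ →₀ ℕ)}

/-- If the `a i` have disjoint supports, then at a point of the support of `a i` a combination
of the `a j` only sees `a i`. -/
lemma sum_smul_apply_of_disjoint_support
    (hdisj : Pairwise fun i j ↦ Disjoint (a i).support (a j).support)
    (k : ι → ℕ) {i : ι} {x : σ} (hx : a i x ≠ 0) :
    (∑ j, k j • a j) x = k i * a i x := by
  rw [Finsupp.finsetSum_apply, Finset.sum_eq_single i]
  · simp
  · intro j _ hji
    have : x ∉ (a j).support :=
      Finset.disjoint_left.mp (hdisj hji.symm) (Finsupp.mem_support_iff.mpr hx)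
    simp [Finsupp.notMem_support_iff.mp this]
  · simp

lemma coeff_le_of_add_sum_smul_eq
    (hdisj : Pairwise fun i j ↦ Disjoint (a i).support (a j).support)
    {b b' : σ →₀ ℕ} {k k' : ι → ℕ} (hb : ∀ i, ¬ a i ≤ b)
    (h : b + ∑ j, k j • a j = b' + ∑ j, k' j • a j) (i : ι) : k' i ≤ k i := by
  by_contra! hlt
  refine hb i fun x ↦ ?_
  by_cases hx : a i x = 0
  · simp [hx]
  have hc := DFunLike.congr_fun h x
  simp only [Finsupp.add_apply, sum_smul_apply_of_disjoint_support hdisj _ hx] at hc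
  nlinarith

lemma exists_add_sum_smul_eq (ha : ∀ i, a i ≠ 0) (c : σ →₀ ℕ) :
    ∃ b : σ →₀ ℕ, (∀ i, ¬ a i ≤ b) ∧ ∃ k : ι →₀ ℕ, b + ∑ j, k j • a j = c := by
  classical
  induction hd : c.degree using Nat.strong_induction_on generalizing c with
  | _ d ih =>
    by_cases hc : ∀ i, ¬ a i ≤ c
    · exact ⟨c, hc, 0, by simp⟩
    push Not at hc
    obtain ⟨i, hi⟩ := hc
    obtain ⟨e, rfl⟩ := exists_add_of_le hi
    have hpos : (a i).degree ≠ 0 := fun h ↦ ha i ((Finsupp.degree_eq_zero_iff _).mp h)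
    obtain ⟨b, hb, k, hk⟩ := ih e.degree (by rw [map_add] at hd; omega) e rfl
    refine ⟨b, hb, k + Finsupp.single i 1, ?_⟩
    have hs : ∑ j, Finsupp.single i 1 j • a j = a i := by
      rw [Finset.sum_eq_single i] <;> simp +contextual [eq_comm]
    simp only [Finsupp.add_apply, add_smul, Finset.sum_add_distrib, hs, ← hk]
    abel

lemma bijective_add_sum_smul (ha : ∀ i, a i ≠ 0)
    (hdisj : Pairwise fun i j ↦ Disjoint (a i).support (a j).support) :
    Function.Bijective fun p : (_ : {b : σ →₀ ℕ // ∀ i, ¬ a i ≤ b}) × (ι →₀ ℕ) ↦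
      p.1.1 + ∑ j, p.2 j • a j := by
  constructor
  · rintro ⟨⟨b, hb⟩, k⟩ ⟨⟨b', hb'⟩, k'⟩ h
    obtain rfl : k = k' := Finsupp.ext fun i ↦
      (coeff_le_of_add_sum_smul_eq hdisj hb' h.symm i).antisymm
        (coeff_le_of_add_sum_smul_eq hdisj hb h i)
    obtain rfl : b = b' := add_right_cancel h
    rfl
  · intro c
    obtain ⟨b, hb, k, hk⟩ := exists_add_sum_smul_eq ha c
    exact ⟨⟨⟨b, hb⟩, k⟩, hk⟩

end ExponentDecomposition

lemma MvPolynomial.algHom_monomial_of_X_eq_monomial {R σ ι : Type*} [CommSemiring R] [Fintype ι]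
    {a : ι → (σ →₀ ℕ)} (φ : MvPolynomial ι R →ₐ[R] MvPolynomial σ R)
    (hφ : ∀ i, φ (X i) = monomial (a i) 1) (k : ι →₀ ℕ) :
    φ (monomial k 1) = monomial (∑ j, k j • a j) 1 := by
  rw [monomial_eq, C_1, one_mul, Finsupp.prod_fintype _ _ (by simp), map_prod, monomial_sum_one]
  simp [hφ, monomial_pow]

/-- A substitution of monic monomials of positive degree with pairwise disjoint supports makes
the target a free module: a basis is given by the monomials divisible by none of them. -/
theorem MvPolynomial.free_of_X_eq_monomial {R σ ι : Type*} [CommRing R] [Fintype ι]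
    {a : ι → (σ →₀ ℕ)} (ha : ∀ i, a i ≠ 0)
    (hdisj : Pairwise fun i j ↦ Disjoint (a i).support (a j).support)
    (φ : MvPolynomial ι R →ₐ[R] MvPolynomial σ R)
    (hφ : ∀ i, φ (X i) = monomial (a i) 1) :
    letI := φ.toRingHom.toAlgebra
    Module.Free (MvPolynomial ι R) (MvPolynomial σ R) := by
  let := φ.toRingHom.toAlgebra
  have : IsScalarTower R (MvPolynomial ι R) (MvPolynomial σ R) :=
    IsScalarTower.of_algebraMap_eq fun r ↦ (φ.commutes r).symm
  let B := {b : σ →₀ ℕ // ∀ i, ¬ a i ≤ b}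
  let f : (B →₀ MvPolynomial ι R) →ₗ[MvPolynomial ι R] MvPolynomial σ R :=
    Finsupp.linearCombination _ fun b : B ↦ monomial b.1 1
  let e := (Finsupp.basis fun _ : B ↦ basisMonomials ι R).equiv (basisMonomials σ R)
    (Equiv.ofBijective _ (bijective_add_sum_smul ha hdisj))
  have hfe : f.restrictScalars R = e.toLinearMap := by
    refine (Finsupp.basis fun _ : B ↦ basisMonomials ι R).ext fun p ↦ ?_
    rw [LinearEquiv.coe_coe, Module.Basis.equiv_apply]
    have hsmul (q : MvPolynomial ι R) (s : MvPolynomial σ R) : q • s = φ q * s := rfl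
    simp [f, hsmul, algHom_monomial_of_X_eq_monomial φ hφ, monomial_mul, add_comm]
  have hf : Function.Bijective f := by
    have : ⇑f = e := congrArg DFunLike.coe hfe
    exact this ▸ e.bijective
  exact Module.Free.of_equiv (LinearEquiv.ofBijective f hf)

/-- Let `u_1, …, u_m` be monomials in `S = K[x_1,…,x_n]`, each of positive degree
and with pairwise disjoint supports, and let `φ : R = K[y_1,…,y_m] → S` be the `K`-algebra map
with `φ(y_i) = u_i`. Then `S`, regarded as an `R`-module via `φ`, is flat. -/
theorem stmt10 {K : Type*} [Field K] {n m : ℕ}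
    (a : Fin m → (Fin n →₀ ℕ)) (ha : ∀ i, a i ≠ 0)
    (u : Fin m → MvPolynomial (Fin n) K)
    (hu : ∀ i, u i = monomial (a i) 1)
    (hdisj : ∀ i j, i ≠ j → Disjoint (a i).support (a j).support)
    (φ : MvPolynomial (Fin m) K →ₐ[K] MvPolynomial (Fin n) K)
    (hφ : ∀ i, φ (X i) = u i) :
    RingHom.Flat φ.toRingHom := by
  simp only [hu] at hφ
  let := φ.toRingHom.toAlgebra
  have := MvPolynomial.free_of_X_eq_monomial ha (fun i j h ↦ hdisj i j h) φ hφ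
  exact Module.Flat.of_free
end
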